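/- In the iterative local-dominance dynamics from the truthful state (all voters of type r, ℓ1 metric, singleton scheduler), the gap between the winner's score and the runner-up's score never exceeds r + 1 as long as some strategic interaction remains possible; equivalently, whenever a strategic step occurs at state s, the set H̄_{r+1}(s) contains at least two candidates. -/

import Mathlib

open Finset

/-- The Plurality winner of a score vector: highest score, ties broken
lexicographically (smallest index wins). -/
noncomputable def winner {m : ℕ} [NeZero m] (s : Fin m → ℕ) : Fin m :=
  (Finset.univ.filter fun c => ∀ d, s d ≤ s c).min'
    (by
      obtain ⟨c, hc⟩ := Finite.exists_max s
      exact ⟨c, Finset.mem_filter.mpr ⟨Finset.mem_univ c, hc⟩⟩)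

/-- Add one vote for candidate `x` to score vector `s`. -/
def addVote {m : ℕ} (s : Fin m → ℕ) (x : Fin m) : Fin m → ℕ :=
  fun c => s c + if c = x then 1 else 0

/-- The winner after one additional vote for `x` is added to `s`. -/
noncomputable def outcome {m : ℕ} [NeZero m] (s : Fin m → ℕ) (x : Fin m) : Fin m :=
  winner (addVote s x)

/-- Action `b` S-beats action `c` (w.r.t. strict preference `pref`). -/
def Beats {m : ℕ} [NeZero m] (S : Set (Fin m → ℕ)) (pref : Fin m → Fin m → Prop)
    (b c : Fin m) : Prop :=
  ∃ s ∈ S, pref (outcome s b) (outcome s c)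

/-- Action `b` S-dominates action `c`. -/
def Dominates {m : ℕ} [NeZero m] (S : Set (Fin m → ℕ)) (pref : Fin m → Fin m → Prop)
    (b c : Fin m) : Prop :=
  Beats S pref b c ∧ ¬ Beats S pref c b

/-- ℓ1 distance between score vectors. -/
def l1 {m : ℕ} (s s' : Fin m → ℕ) : ℕ := ∑ c, Nat.dist (s c) (s' c)

/-- Scores of the profile `a` excluding voter `i`'s vote. -/
def scoreExc {m n : ℕ} (a : Fin n → Fin m) (i : Fin n) : Fin m → ℕ :=
  fun c => (Finset.univ.filter fun j => j ≠ i ∧ a j = c).card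

/-- Scores of the full profile `a`. -/
def scoreOf {m n : ℕ} (a : Fin n → Fin m) : Fin m → ℕ :=
  fun c => (Finset.univ.filter fun j => a j = c).card

/-- The accessible set `S_i(a, r)`: ℓ1 ball of radius `r` around the scores of the others. -/
def ball {m n : ℕ} (a : Fin n → Fin m) (i : Fin n) (r : ℕ) : Set (Fin m → ℕ) :=
  {s' | l1 s' (scoreExc a i) ≤ r}

/-- Possible winners for voter `i` at state `a` with uncertainty `r`. -/
noncomputable def PossW {m n : ℕ} [NeZero m] (a : Fin n → Fin m) (i : Fin n) (r : ℕ) :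
    Set (Fin m) :=
  {c | ∃ s' ∈ ball a i r, outcome s' c = c}

/-- `H̄_w(s)`: candidates within `w` votes of the winner's score. -/
noncomputable def Hbar {m : ℕ} [NeZero m] (w : ℕ) (s : Fin m → ℕ) : Set (Fin m) :=
  {c | s (winner s) ≤ s c + w}

/-- The set of candidates locally dominating voter `i`'s current vote. -/
noncomputable def Dset {m n : ℕ} [NeZero m] (Q : Fin n → Fin m → Fin m → Prop) (r : ℕ)
    (a : Fin n → Fin m) (i : Fin n) : Set (Fin m) :=
  {c | Dominates (ball a i r) (Q i) c (a i)}

/-- `c` is voter `i`'s local-dominance strategic response at `a`: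
`c` locally dominates `a i` and is `i`'s most preferred such candidate. -/
noncomputable def Resp {m n : ℕ} [NeZero m] (Q : Fin n → Fin m → Fin m → Prop) (r : ℕ)
    (a : Fin n → Fin m) (i : Fin n) (c : Fin m) : Prop :=
  c ∈ Dset Q r a i ∧ ∀ d ∈ Dset Q r a i, d ≠ c → Q i c d

/-- One singleton strategic step: one voter moves to her strategic response. -/
noncomputable def StepRel {m n : ℕ} [NeZero m] (Q : Fin n → Fin m → Fin m → Prop) (r : ℕ)
    (a a' : Fin n → Fin m) : Prop :=
  ∃ i, (∀ j, j ≠ i → a' j = a j) ∧ a' i ≠ a i ∧ Resp Q r a i (a' i)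

/-- A voting equilibrium: no voter votes for a locally dominated candidate. -/
noncomputable def Equilibrium {m n : ℕ} [NeZero m] (Q : Fin n → Fin m → Fin m → Prop) (r : ℕ)
    (a : Fin n → Fin m) : Prop :=
  ∀ i, Dset Q r a i = ∅

/-- A truthful profile: each voter votes for her unique top candidate. -/
def Truthful {m n : ℕ} (Q : Fin n → Fin m → Fin m → Prop) (a : Fin n → Fin m) : Prop :=
  ∀ i, ∀ d, d ≠ a i → Q i (a i) d

lemma winner_eq_iff {m : ℕ} [NeZero m] (s : Fin m → ℕ) (c : Fin m) :
    winner s = c ↔ ∀ d, s d < s c ∨ (s d = s c ∧ c ≤ d) := by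
  have hmem : ∀ x ∈ Finset.univ.filter fun c => ∀ d, s d ≤ s c, winner s ≤ x :=
    fun x hx => Finset.min'_le _ x hx
  have hw : winner s ∈ Finset.univ.filter fun c => ∀ d, s d ≤ s c := Finset.min'_mem _ _
  simp only [Finset.mem_filter, Finset.mem_univ, true_and] at hmem hw
  constructor
  · rintro rfl d
    rcases (hw d).lt_or_eq with h | h
    · exact Or.inl h
    · exact Or.inr ⟨h, hmem d fun e => h ▸ hw e⟩
  · intro h
    have hc : winner s ≤ c := hmem c fun d => by
      rcases h d with h | h <;> omega
    have h1 := h (winner s)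
    have h2 := hw c
    rcases h1 with h1 | h1
    · omega
    · exact le_antisymm hc h1.2

lemma winner_spec {m : ℕ} [NeZero m] (s : Fin m → ℕ) (d : Fin m) :
    s d < s (winner s) ∨ (s d = s (winner s) ∧ winner s ≤ d) :=
  (winner_eq_iff s _).1 rfl d

lemma outcome_spec {m : ℕ} [NeZero m] (s : Fin m → ℕ) (x d : Fin m) :
    addVote s x d < addVote s x (outcome s x) ∨
      (addVote s x d = addVote s x (outcome s x) ∧ outcome s x ≤ d) :=
  winner_spec _ d

/-- A vote that does not elect its own candidate does not change the winner. -/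
lemma outcome_eq_winner {m : ℕ} [NeZero m] {s : Fin m → ℕ} {x : Fin m}
    (h : outcome s x ≠ x) : outcome s x = winner s := by
  refine ((winner_eq_iff s _).2 fun d => ?_).symm
  have h1 := outcome_spec s x d
  simp only [addVote, if_neg h] at h1
  split_ifs at h1 <;> omega

lemma outcome_eq_self_or {m : ℕ} [NeZero m] {s : Fin m → ℕ} {b c : Fin m}
    (h : outcome s b ≠ outcome s c) : outcome s b = b ∨ outcome s c = c := by
  by_contra! hn
  exact h ((outcome_eq_winner hn.1).trans (outcome_eq_winner hn.2).symm)

/-- The candidates that win once `r + 1` votes are added to their score in `s`. -/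
def Viable {m : ℕ} (r : ℕ) (s : Fin m → ℕ) : Set (Fin m) :=
  {d | ∀ c, s c < s d + (r + 1) ∨ (s c = s d + (r + 1) ∧ d ≤ c)}

lemma winner_mem_viable {m : ℕ} [NeZero m] (r : ℕ) (s : Fin m → ℕ) : winner s ∈ Viable r s := by
  intro c
  have := winner_spec s c
  omega

lemma score_bounds_of_l1_le {m : ℕ} {s s' : Fin m → ℕ} {r : ℕ} (h : l1 s' s ≤ r) {c d : Fin m}
    (hcd : c ≠ d) : s c + s' d ≤ s' c + s d + r := by
  have h1 : ∑ x ∈ {c, d}, Nat.dist (s' x) (s x) ≤ l1 s' s :=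
    Finset.sum_le_sum_of_subset (Finset.subset_univ _)
  rw [Finset.sum_pair hcd] at h1
  simp only [Nat.dist] at h1
  omega

lemma outcome_mem_viable {m : ℕ} [NeZero m] {s s' : Fin m → ℕ} {r : ℕ} (h : l1 s' s ≤ r)
    (e : Fin m) : outcome s' e ∈ Viable r s := by
  intro c
  by_cases hc : c = outcome s' e
  · rw [← hc]; omega
  have h1 := score_bounds_of_l1_le h hc
  have h2 := outcome_spec s' e c
  simp only [addVote] at h2
  split_ifs at h2 <;> omega

lemma l1_update_add {m : ℕ} (s : Fin m → ℕ) (x : Fin m) (k : ℕ) :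
    l1 (Function.update s x (s x + k)) s = k := by
  unfold l1
  rw [Finset.sum_eq_single x]
  · simp [Nat.dist]
  · intro b _ hb
    simp [Function.update_of_ne hb]
  · simp

/-- If the vote can matter at all, then a voter can be pivotal for any viable candidate `d`. -/
lemma exists_pivotal {m : ℕ} [NeZero m] {s s' : Fin m → ℕ} {r : ℕ} {d e : Fin m}
    (hd : d ∈ Viable r s) (h : l1 s' s ≤ r) (he : outcome s' e ≠ e) (hed : outcome s' e ≠ d) :
    ∃ u, l1 u s ≤ r ∧ outcome u d = d ∧ ∀ c, c ≠ d → outcome u c ≠ d := by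
  have hw := winner_spec s
  by_cases hdw : d = winner s
  · rw [← hdw] at hw
    generalize hy : outcome s' e = y at he hed
    obtain ⟨k, hk⟩ : ∃ k, s y + k = s d + if y < d then 0 else 1 := by
      refine ⟨(s d + if y < d then 0 else 1) - s y, ?_⟩
      have := hw y
      split_ifs <;> omega
    refine ⟨Function.update s y (s y + k), ?_, ?_, ?_⟩
    · rw [l1_update_add]
      have h1 := score_bounds_of_l1_le h (Ne.symm hed)
      have h2 := outcome_spec s' e d
      rw [hy] at h2
      simp only [addVote, if_neg he] at h2
      split_ifs at hk h2 <;> omega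
    · refine (winner_eq_iff _ _).2 fun c => ?_
      have hc := hw c
      simp only [addVote, Function.update_apply, if_neg (Ne.symm hed), if_true]
      split_ifs at hk ⊢ <;> subst_vars <;> omega
    · intro c hc hcd
      have h2 := outcome_spec (Function.update s y (s y + k)) c y
      rw [hcd] at h2
      simp only [addVote, Function.update_apply, if_neg (Ne.symm hed), if_neg (Ne.symm hc),
        if_true] at h2
      split_ifs at hk h2 <;> omega
  · generalize winner s = w at hw hdw
    have hwd := hw d
    obtain ⟨k, hk⟩ : ∃ k, s d + (k + 1) = s w + if d < w then 0 else 1 := by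
      refine ⟨(s w + if d < w then 0 else 1) - s d - 1, ?_⟩
      split_ifs <;> omega
    refine ⟨Function.update s d (s d + k), ?_, ?_, ?_⟩
    · rw [l1_update_add]
      have := hd w
      split_ifs at hk <;> omega
    · refine (winner_eq_iff _ _).2 fun c => ?_
      have hc := hw c
      simp only [addVote, Function.update_apply, if_true]
      split_ifs at hk ⊢ <;> subst_vars <;> omega
    · intro c hc hcd
      have h2 := outcome_spec (Function.update s d (s d + k)) c w
      rw [hcd] at h2
      simp only [addVote, Function.update_apply, if_neg (Ne.symm hdw), if_neg (Ne.symm hc),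
        if_true] at h2
      split_ifs at hk h2 <;> omega

/-- Starting from a vote that is preferred to every other viable candidate, a strategic response
abandons a nonviable candidate for the best viable one, and another viable candidate exists. -/
lemma response_viable {m n : ℕ} [NeZero m] {Q : Fin n → Fin m → Fin m → Prop} {r : ℕ}
    {a : Fin n → Fin m} {i : Fin n} {b : Fin m} (hQ : IsStrictTotalOrder (Fin m) (Q i))
    (hinv : ∀ d, Q i d (a i) → d ∉ Viable r (scoreExc a i)) (hresp : Resp Q r a i b) :
    a i ∉ Viable r (scoreExc a i) ∧ b ∈ Viable r (scoreExc a i) ∧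
      (∀ d, Q i d b → d ∉ Viable r (scoreExc a i)) ∧
      ∃ y ∈ Viable r (scoreExc a i), y ≠ b := by
  obtain ⟨⟨⟨s', hs', hbeat⟩, hnot⟩, hbest⟩ := hresp
  have hs : l1 s' (scoreExc a i) ≤ r := hs'
  have hirr : ∀ x, ¬ Q i x x := fun x => hQ.irrefl x
  have htri : ∀ {x y}, x ≠ y → ¬ Q i x y → Q i y x := fun {x y} hne hxy => by
    by_contra hyx
    exact hne (hQ.trichotomous x y hxy hyx)
  have hne : outcome s' b ≠ outcome s' (a i) := fun h => by
    rw [h] at hbeat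
    exact hirr _ hbeat
  have hxV := outcome_mem_viable hs b
  have hyV := outcome_mem_viable hs (a i)
  have hya : outcome s' (a i) ≠ a i := fun h => by
    rw [h] at hbeat
    exact hinv _ hbeat hxV
  have hxb : outcome s' b = b := (outcome_eq_self_or hne).resolve_right hya
  rw [hxb] at hbeat hne hxV
  have haV : a i ∉ Viable r (scoreExc a i) := fun haV => by
    obtain ⟨u, hu, hua, hub⟩ := exists_pivotal haV hs hya hya
    have hba : b ≠ a i := by
      rintro rfl
      exact hya hxb
    refine hnot ⟨u, hu, ?_⟩
    rw [hua]
    exact htri (hub b hba) fun h => hinv _ h (outcome_mem_viable hu b)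
  refine ⟨haV, hxV, ?_, _, hyV, hne.symm⟩
  have hwf : WellFounded (Q i) := Finite.wellFounded_of_trans_of_irrefl (Q i)
  obtain ⟨d, hdV, hdmin⟩ := hwf.has_min (Viable r (scoreExc a i)) ⟨b, hxV⟩
  suffices h : d = b from h ▸ fun x hx hxV => hdmin x hxV hx
  by_contra hdb
  have hyd : outcome s' (a i) ≠ d := fun h => hdmin b hxV (h ▸ hbeat)
  have hda : a i ≠ d := fun h => haV (h ▸ hdV)
  refine hdmin b hxV (hbest d ⟨?_, ?_⟩ hdb)
  · obtain ⟨u, hu, hud, huc⟩ := exists_pivotal hdV hs hya hyd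
    refine ⟨u, hu, ?_⟩
    rw [hud]
    exact htri (huc _ hda) (hdmin _ (outcome_mem_viable hu _))
  · rintro ⟨u, hu, hq⟩
    have hne' : outcome u (a i) ≠ outcome u d := fun h => by
      rw [h] at hq
      exact hirr _ hq
    rcases outcome_eq_self_or hne' with h | h
    · exact haV (h ▸ outcome_mem_viable hu (a i))
    · rw [h] at hq
      exact hdmin _ (outcome_mem_viable hu _) hq

lemma scoreOf_eq_scoreExc_add {m n : ℕ} (a : Fin n → Fin m) (i : Fin n) (c : Fin m) :
    scoreOf a c = scoreExc a i c + if a i = c then 1 else 0 := by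
  simp only [scoreOf, scoreExc, Finset.card_filter]
  rw [← Finset.add_sum_erase _ _ (Finset.mem_univ i), add_comm]
  congr 1
  rw [← Finset.add_sum_erase _ (fun j => if j ≠ i ∧ a j = c then 1 else 0) (Finset.mem_univ i)]
  simp only [ne_eq, not_true_eq_false, false_and, if_false, zero_add]
  refine Finset.sum_congr rfl fun j hj => ?_
  simp [Finset.ne_of_mem_erase hj]

lemma scoreExc_congr {m n : ℕ} {a a' : Fin n → Fin m} {i : Fin n}
    (h : ∀ j, j ≠ i → a' j = a j) : scoreExc a' i = scoreExc a i := by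
  funext c
  simp only [scoreExc]
  congr 1
  refine Finset.filter_congr fun j _ => and_congr_right fun hj => by rw [h j hj]

/-- A move from a nonviable to a viable candidate makes no candidate preferred to another voter's
current vote viable for that voter. -/
lemma not_viable_of_move {m n : ℕ} {r : ℕ} {a a' : Fin n → Fin m} {i j : Fin n}
    (hoff : ∀ k, k ≠ i → a' k = a k) (hji : j ≠ i)
    (ha : a i ∉ Viable r (scoreExc a i)) (hb : a' i ∈ Viable r (scoreExc a i))
    {d : Fin m} (hda : d ≠ a j) (hd : d ∉ Viable r (scoreExc a j)) :
    d ∉ Viable r (scoreExc a' j) := by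
  have hba : a' i ≠ a i := fun h => ha (h ▸ hb)
  have hi : ∀ c, scoreOf a c = scoreExc a i c + if a i = c then 1 else 0 :=
    scoreOf_eq_scoreExc_add a i
  have hi' : ∀ c, scoreOf a' c = scoreExc a i c + if a' i = c then 1 else 0 := fun c => by
    rw [scoreOf_eq_scoreExc_add a' i, scoreExc_congr hoff]
  have hj : ∀ c, scoreOf a c = scoreExc a j c + if a j = c then 1 else 0 :=
    scoreOf_eq_scoreExc_add a j
  have hj' : ∀ c, scoreOf a' c = scoreExc a' j c + if a j = c then 1 else 0 := fun c => by
    rw [scoreOf_eq_scoreExc_add a' j, hoff j hji]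
  generalize a' i = b at *
  generalize a i = p at *
  generalize a j = q at *
  simp only [Viable, Set.mem_ofPred_eq, not_forall, not_or, not_and, not_lt, not_le] at ha hd ⊢
  obtain ⟨c', hc'⟩ := ha
  obtain ⟨c, hc⟩ := hd
  have hbc := hb c
  have hbc' := hb c'
  by_cases hdb : d = b
  · grind
  by_cases hcp : c = p
  · by_cases hbq : b = q
    · exact ⟨c', by grind⟩
    · exact ⟨b, by grind⟩
  · exact ⟨c, by grind⟩

lemma viable_subset_Hbar {m n : ℕ} [NeZero m] {r : ℕ} {a : Fin n → Fin m} {i : Fin n}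
    (ha : a i ∉ Viable r (scoreExc a i)) :
    Viable r (scoreExc a i) ⊆ Hbar (r + 1) (scoreOf a) := by
  intro y hy
  have hs := scoreOf_eq_scoreExc_add a i
  have hya : a i ≠ y := fun h => ha (h ▸ hy)
  have hw := winner_spec (scoreOf a)
  have hyw := hy (winner (scoreOf a))
  simp only [Hbar, Set.mem_ofPred_eq]
  simp only [Viable, Set.mem_ofPred_eq, not_forall, not_or, not_and, not_lt, not_le] at ha
  obtain ⟨c, hc⟩ := ha
  have h1 := hw c
  have h2 := hs c
  have h3 := hs (winner (scoreOf a))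
  have h4 := hs y
  have h5 := hy c
  rw [if_neg hya] at h4
  split_ifs at h2 h3 <;> simp_all <;> omega

/-- Along the dynamics, no voter prefers a viable candidate to her current vote. -/
lemma not_viable_of_prefers {m n : ℕ} [NeZero m] {Q : Fin n → Fin m → Fin m → Prop}
    (hQ : ∀ i, IsStrictTotalOrder (Fin m) (Q i)) {r T : ℕ} {seq : ℕ → Fin n → Fin m}
    (h0 : Truthful Q (seq 0)) (hstep : ∀ t, t < T → StepRel Q r (seq t) (seq (t + 1)))
    {t : ℕ} (ht : t ≤ T) (j : Fin n) (d : Fin m) (hd : Q j d (seq t j)) :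
    d ∉ Viable r (scoreExc (seq t) j) := by
  have hirr : ∀ j x, ¬ Q j x x := fun j x => (hQ j).irrefl x
  induction t generalizing j d with
  | zero =>
    by_cases h : d = seq 0 j
    · exact absurd (h ▸ hd) (hirr j _)
    · exact absurd ((hQ j).trans _ _ _ hd (h0 j d h)) (hirr j _)
  | succ t ih =>
    obtain ⟨i, hoff, -, hresp⟩ := hstep t ht
    obtain ⟨ha, hb, hbest, -⟩ := response_viable (hQ i) (ih (by omega) i) hresp
    by_cases hji : j = i
    · subst hji
      rw [scoreExc_congr hoff]
      exact hbest d hd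
    · rw [hoff j hji] at hd
      exact not_viable_of_move hoff hji ha hb (fun h => hirr j _ (h ▸ hd)) (ih (by omega) j d hd)

/-- in the iterative local-dominance dynamics from the truthful state,
whenever a strategic step occurs at state `s^t`, the set `H̄_{r+1}(s^t)` contains at least
two candidates (equivalently, the winner–runner-up gap never exceeds `r + 1` while
strategic interaction remains possible). -/
theorem gap_bounded_while_steps_remain {m n : ℕ} [NeZero m]
    (Q : Fin n → Fin m → Fin m → Prop)
    (hQ : ∀ i, IsStrictTotalOrder (Fin m) (Q i)) (r T : ℕ)
    (seq : ℕ → Fin n → Fin m)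
    (h0 : Truthful Q (seq 0))
    (hstep : ∀ t, t < T → StepRel Q r (seq t) (seq (t + 1))) :
    ∀ t, t < T → 2 ≤ (Hbar (r + 1) (scoreOf (seq t))).ncard := by
  intro t ht
  obtain ⟨i, -, -, hresp⟩ := hstep t ht
  obtain ⟨ha, hb, -, y, hy, hyb⟩ :=
    response_viable (hQ i) (not_viable_of_prefers hQ h0 hstep ht.le i) hresp
  have hsub := viable_subset_Hbar ha
  exact (Set.one_lt_ncard (Set.toFinite _)).2 ⟨y, hsub hy, _, hsub hb, hyb⟩
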